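/- (Expected GradCAM lower bound at initialization.) Let m ∈ ℝ^{k×k} be a fixed patch with ‖m‖₂ > 0. For q = 1, …, V let F^{(q)} be k×k matrices with i.i.d. N(0, τ²) entries, independent across q, and set B_q := max(0, ⟨F^{(q)}, m⟩). Independently, let α_q be random variables that, conditionally on (F^{(1)}, …, F^{(V)}), are i.i.d. centered Gaussians with variance (τ/(hw))²·(h'w'/2). If V > 20, then E[max(0, Σ_{q=1}^{V} α_q B_q)] ≥ ((V − 20)/√V) · √(h'w'/(16π)) · (τ²/(hw)) · ‖m‖₂. -/

import Mathlib

open MeasureTheory ProbabilityTheory Real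

lemma aux_map_sum {ι : Type*} [Fintype ι] (v : NNReal) (a : ι → ℝ) :
    (Measure.pi fun _ : ι => gaussianReal 0 v).map (fun x => ∑ i, x i * a i) =
      gaussianReal 0 (v * Real.toNNReal (∑ i, a i ^ 2)) := by
  apply Measure.ext_of_charFun
  have hind : iIndepFun (fun (i : ι) (x : ι → ℝ) => x i * a i)
      (Measure.pi fun _ : ι => gaussianReal 0 v) :=
    iIndepFun_pi (X := fun i (y : ℝ) => y * a i) (fun i => by fun_prop)
  rw [hind.charFun_map_fun_sum_eq_prod (fun i => Measurable.aemeasurable (by fun_prop))]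
  ext t
  have h1 : ∀ i, (Measure.pi fun _ : ι => gaussianReal 0 v).map (fun x => x i * a i)
      = gaussianReal 0 (NNReal.mk (a i ^ 2) (sq_nonneg _) * v) := by
    intro i
    have := (measurePreserving_eval (fun _ : ι => gaussianReal 0 v) i).map_eq
    have h2 := gaussianReal_map_mul_const (μ := 0) (v := v) (a i)
    rw [← this, Measure.map_map (by fun_prop) (by fun_prop)] at h2
    rw [mul_zero] at h2
    exact h2
  simp only [h1, Finset.prod_apply, charFun_gaussianReal]
  rw [← Complex.exp_sum]
  congr 1
  have h3 : ((Real.toNNReal (∑ i, a i ^ 2) : NNReal) : ℝ) = ∑ i, a i ^ 2 :=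
    Real.coe_toNNReal _ (Finset.sum_nonneg fun i _ => sq_nonneg _)
  simp only [NNReal.coe_mul, h3, NNReal.coe_mk]
  push_cast
  rw [Finset.mul_sum, Finset.sum_mul, Finset.sum_div]
  simp [Finset.sum_neg_distrib]
  refine Finset.sum_congr rfl fun i _ => by ring

lemma aux_moment (n : ℕ) (hn : n ≠ 0) (v : NNReal) (hv : v ≠ 0) :
    ∫ x, (max 0 x) ^ n ∂(gaussianReal 0 v) =
      (√(2 * π * v))⁻¹ * ((1 / (2 * (v : ℝ))) ^ (-((n : ℝ) + 1) / 2) * (1 / 2) *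
        Gamma (((n : ℝ) + 1) / 2)) := by
  have hv' : (0 : ℝ) < v := by positivity
  rw [integral_gaussianReal_eq_integral_smul hv]
  rw [← integral_rpow_mul_exp_neg_mul_rpow (p := 2) (q := n) (b := 1 / (2 * (v : ℝ)))
    two_pos (by have : (0 : ℝ) ≤ n := Nat.cast_nonneg n
                linarith) (by positivity)]
  rw [← integral_const_mul, ← integral_indicator measurableSet_Ioi]
  congr 1
  ext x
  by_cases hx : 0 < x
  · rw [Set.indicator_of_mem (by exact hx), max_eq_right hx.le, gaussianPDFReal]
    simp only [smul_eq_mul, Real.rpow_natCast, Real.rpow_two, sub_zero]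
    rw [show -x ^ 2 / (2 * (v : ℝ)) = -(1 / (2 * (v : ℝ))) * x ^ 2 by ring]
    ring
  · rw [Set.indicator_of_notMem (by exact hx), max_eq_left (not_lt.1 hx)]
    simp [hn]

lemma aux_one (v : NNReal) :
    ∫ x, max 0 x ∂(gaussianReal 0 v) = √v / √(2 * π) := by
  rcases eq_or_ne v 0 with rfl | hv
  · simp
  have hv' : (0 : ℝ) < v := by positivity
  have := aux_moment 1 one_ne_zero v hv
  simp only [pow_one] at this
  rw [this]
  norm_num
  rw [Real.rpow_neg_one]
  have h := Real.mul_self_sqrt hv'.le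
  have : √(v:ℝ) ≠ 0 := by positivity
  field_simp
  nlinarith

lemma aux_two (v : NNReal) (hv : v ≠ 0) :
    ∫ x, (max 0 x) ^ 2 ∂(gaussianReal 0 v) = v / 2 := by
  have hv' : (0 : ℝ) < v := by positivity
  rw [aux_moment 2 two_ne_zero v hv]
  have hg : Gamma ((((2 : ℕ) : ℝ) + 1) / 2) = √π / 2 := by
    rw [show (((2 : ℕ) : ℝ) + 1) / 2 = 1 / 2 + 1 by norm_num, Real.Gamma_add_one (by norm_num),
      Real.Gamma_one_half_eq]
    ring
  have hp : (1 / (2 * (v : ℝ))) ^ (-(((2 : ℕ) : ℝ) + 1) / 2) = (2 * v) * √(2 * v) := by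
    rw [one_div, Real.inv_rpow (by positivity), ← Real.rpow_neg (by positivity),
      show -(-(((2 : ℕ) : ℝ) + 1) / 2) = 1 + 1 / 2 by norm_num, Real.rpow_add (by positivity),
      Real.rpow_one, Real.sqrt_eq_rpow]
  rw [hg, hp, show 2 * π * (v : ℝ) = π * (2 * v) by ring, Real.sqrt_mul pi_pos.le]
  have : √(2 * (v : ℝ)) ≠ 0 := by positivity
  have : √π ≠ 0 := by positivity
  field_simp

lemma aux_four (v : NNReal) (hv : v ≠ 0) :
    ∫ x, (max 0 x) ^ 4 ∂(gaussianReal 0 v) = 3 * v ^ 2 / 2 := by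
  have hv' : (0 : ℝ) < v := by positivity
  rw [aux_moment 4 (by norm_num) v hv]
  have hg : Gamma ((((4 : ℕ) : ℝ) + 1) / 2) = 3 * √π / 4 := by
    rw [show (((4 : ℕ) : ℝ) + 1) / 2 = (1 / 2 + 1) + 1 by norm_num,
      Real.Gamma_add_one (by norm_num), Real.Gamma_add_one (by norm_num),
      Real.Gamma_one_half_eq]
    ring
  have hp : (1 / (2 * (v : ℝ))) ^ (-(((4 : ℕ) : ℝ) + 1) / 2) = (2 * v) ^ 2 * √(2 * v) := by
    rw [one_div, Real.inv_rpow (by positivity), ← Real.rpow_neg (by positivity),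
      show -(-(((4 : ℕ) : ℝ) + 1) / 2) = 2 + 1 / 2 by norm_num, Real.rpow_add (by positivity),
      Real.rpow_two, Real.sqrt_eq_rpow]
  rw [hg, hp, show 2 * π * (v : ℝ) = π * (2 * v) by ring, Real.sqrt_mul pi_pos.le]
  have : √(2 * (v : ℝ)) ≠ 0 := by positivity
  have : √π ≠ 0 := by positivity
  field_simp
  ring

lemma aux_sqrt (x μ : ℝ) (hx : 0 ≤ x) (hμ : 0 < μ) :
    √μ * ((3 / (2 * μ)) * x - 1 / (2 * μ ^ 2) * x ^ 2) ≤ √x := by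
  obtain ⟨t, ht, rfl⟩ : ∃ t, 0 ≤ t ∧ x = μ * t ^ 2 :=
    ⟨√(x / μ), by positivity, by rw [Real.sq_sqrt (by positivity)]; field_simp⟩
  rw [Real.sqrt_mul hμ.le, Real.sqrt_sq ht]
  refine mul_le_mul_of_nonneg_left ?_ (Real.sqrt_nonneg _)
  have : 3 / (2 * μ) * (μ * t ^ 2) - 1 / (2 * μ ^ 2) * (μ * t ^ 2) ^ 2
    = (3 * t ^ 2 - t ^ 4) / 2 := by field_simp
  rw [this]
  nlinarith [mul_nonneg ht (mul_nonneg (sq_nonneg (t - 1)) (by linarith : 0 ≤ t + 2))]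

lemma aux_norm {Ω : Type*} [MeasurableSpace Ω] (P : Measure Ω) [IsProbabilityMeasure P]
    (V : ℕ) (hV : 0 < V) (Y : Ω → ℝ) (hY0 : ∀ x, 0 ≤ Y x) (hY : MemLp Y 2 P) (s : ℝ) (hs : 0 < s)
    (h1 : ∫ x, Y x ∂P = s / 2) (h2 : ∫ x, Y x ^ 2 ∂P = 3 * s ^ 2 / 2) :
    √(V * s / 2) * (1 - 5 / (2 * V)) ≤
      ∫ ω : Fin V → Ω, √(∑ q, Y (ω q)) ∂(Measure.pi fun _ => P) := by
  have hV' : (0 : ℝ) < V := by exact_mod_cast hV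
  have hvar : Var[Y; P] = 5 * s ^ 2 / 4 := by
    rw [variance_eq_sub hY]
    simp only [Pi.pow_apply, h1, h2]
    ring
  have hvs := variance_sum_pi (ι := Fin V) (μ := fun _ => P) (X := fun _ => Y) (fun _ => hY)
  have hmq : ∀ q : Fin V, MemLp (fun ω : Fin V → Ω => Y (ω q)) 2 (Measure.pi fun _ => P) :=
    fun q => hY.comp_measurePreserving (measurePreserving_eval _ q)
  have hS : MemLp (∑ q : Fin V, fun ω : Fin V → Ω => Y (ω q)) 2 (Measure.pi fun _ => P) :=
    memLp_finsetSum' _ fun q _ => hmq q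
  have hES : ∫ ω : Fin V → Ω, (∑ q : Fin V, fun ω : Fin V → Ω => Y (ω q)) ω
      ∂(Measure.pi fun _ => P) = V * s / 2 := by
    simp only [Finset.sum_apply]
    rw [integral_finsetSum _ fun q _ => (hmq q).integrable (by norm_num)]
    have : ∀ q : Fin V, ∫ ω : Fin V → Ω, Y (ω q) ∂(Measure.pi fun _ => P) = s / 2 := fun q => by
      rw [← h1]; exact integral_comp_eval (μ := fun _ : Fin V => P) hY.aestronglyMeasurable
    simp only [this]
    simp; ring
  rw [variance_eq_sub hS, hES] at hvs
  simp only [hvar, Finset.sum_const, Finset.card_univ, Fintype.card_fin, nsmul_eq_mul,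
    Pi.pow_apply] at hvs
  set S : (Fin V → Ω) → ℝ := ∑ q : Fin V, fun ω : Fin V → Ω => Y (ω q) with hSdef
  have hSa : ∀ ω, ∑ q, Y (ω q) = S ω := fun ω => by simp [hSdef]
  have hS0 : ∀ ω, 0 ≤ S ω := fun ω => by
    rw [← hSa]; exact Finset.sum_nonneg fun q _ => hY0 _
  simp only [hSa]
  have hSi := hS.integrable (by norm_num)
  have hS2 := hS.integrable_sq
  set μ := V * s / 2 with hμ
  have hμ0 : 0 < μ := by positivity
  calc √μ * (1 - 5 / (2 * V))
      = ∫ ω, √μ * ((3 / (2 * μ)) * S ω - 1 / (2 * μ ^ 2) * S ω ^ 2) ∂(Measure.pi fun _ => P) := by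
        rw [integral_const_mul, integral_sub (hSi.const_mul _) (hS2.const_mul _),
          integral_const_mul, integral_const_mul, hES]
        have : ∫ ω, S ω ^ 2 ∂(Measure.pi fun _ => P) = V * (5 * s ^ 2 / 4) + μ ^ 2 := by
          linarith
        rw [this, hμ]
        field_simp
        ring
    _ ≤ _ := by
        refine integral_mono (((hSi.const_mul _).sub (hS2.const_mul _)).const_mul _) ?_
          (fun ω => aux_sqrt _ _ (hS0 ω) hμ0)
        refine Integrable.mono' ((integrable_const 1).add hSi)
          (hSi.aestronglyMeasurable.aemeasurable.sqrt.aestronglyMeasurable) ?_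
        refine ae_of_all _ fun ω => ?_
        rw [Real.norm_of_nonneg (Real.sqrt_nonneg _)]
        simp only [Pi.add_apply]
        rw [Real.sqrt_le_left (by have := hS0 ω; linarith)]
        nlinarith [hS0 ω]


/-- Expected GradCAM score lower bound at initialization (masked CNN, L = 1).
Filters `F q` have i.i.d. `N(0,τ²)` entries; `B q = max 0 ⟨F q, m⟩` is the rectified
convolution of the patch `m`; independently, the GradCAM coefficients `α q` are i.i.d.
centered Gaussians with variance `(τ/(hw))² · (h'w'/2)` (arising from the masked linear
layer). For `V > 20` the expected GradCAM value is at least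
`((V-20)/√V) · √(h'w'/(16π)) · (τ²/(hw)) · ‖m‖₂`. -/
theorem expected_gradcam_lower_bound (h w h' w' k V : ℕ) (hh : 0 < h) (hw : 0 < w)
    (hh' : 0 < h') (hw' : 0 < w') (hV : 20 < V) (τ : ℝ) (hτ : 0 < τ)
    (m : Fin k × Fin k → ℝ) (hm : 0 < Real.sqrt (∑ ij, (m ij) ^ 2)) :
    ((V : ℝ) - 20) / Real.sqrt V * Real.sqrt ((h' * w' : ℕ) / (16 * π)) *
        (τ ^ 2 / (h * w : ℕ)) * Real.sqrt (∑ ij, (m ij) ^ 2) ≤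
      ∫ ω : (Fin V → Fin k × Fin k → ℝ) × (Fin V → ℝ),
        max 0 (∑ q, ω.2 q * max 0 (∑ ij, ω.1 q ij * m ij))
        ∂((Measure.pi fun _ : Fin V =>
              Measure.pi fun _ : Fin k × Fin k => gaussianReal 0 (Real.toNNReal (τ ^ 2))).prod
            (Measure.pi fun _ : Fin V =>
              gaussianReal 0 (Real.toNNReal ((τ / (h * w : ℕ)) ^ 2 * (h' * w' : ℕ) / 2)))) := by
  have hM : 0 < ∑ ij, (m ij) ^ 2 := Real.sqrt_pos.1 hm
  set M := ∑ ij, (m ij) ^ 2 with hMdef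
  set va := Real.toNNReal ((τ / (h * w : ℕ)) ^ 2 * (h' * w' : ℕ) / 2) with hva
  set vf := Real.toNNReal (τ ^ 2) with hvf
  have hvar : (va : ℝ) = (τ / (h * w : ℕ)) ^ 2 * (h' * w' : ℕ) / 2 :=
    Real.coe_toNNReal _ (by positivity)
  have hvfr : (vf : ℝ) = τ ^ 2 := Real.coe_toNNReal _ (by positivity)
  set P : Measure (Fin k × Fin k → ℝ) := Measure.pi fun _ => gaussianReal 0 vf with hP
  set X : (Fin k × Fin k → ℝ) → ℝ := fun f => ∑ ij, f ij * m ij with hX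
  have hXm : Measurable X := by fun_prop
  set s : NNReal := vf * Real.toNNReal M with hs
  have hsr : (s : ℝ) = τ ^ 2 * M := by
    rw [hs, NNReal.coe_mul, hvfr, Real.coe_toNNReal _ hM.le]
  have hs0 : (0 : ℝ) < s := by rw [hsr]; positivity
  have hsne : s ≠ 0 := by
    rintro h0
    rw [h0] at hs0
    simp at hs0
  have hXlaw : P.map X = gaussianReal 0 s := aux_map_sum vf m
  have hXp : MeasurePreserving X P (gaussianReal 0 s) := ⟨hXm, hXlaw⟩
  have hmom : ∀ n : ℕ, ∫ f, (max 0 (X f)) ^ n ∂P = ∫ x, (max 0 x) ^ n ∂(gaussianReal 0 s) := by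
    intro n
    rw [← hXlaw, integral_map hXm.aemeasurable
      (Measurable.aestronglyMeasurable (by fun_prop))]
  have hid : ∀ n : ℕ, Integrable (fun x : ℝ => x ^ n) (gaussianReal 0 s) := by
    intro n
    have := (memLp_id_gaussianReal (μ := 0) (v := s) n).integrable_norm_pow'
    refine Integrable.mono' this (by fun_prop) (ae_of_all _ fun x => ?_)
    simp
  have hY2 : MemLp (fun f => (max 0 (X f)) ^ 2) 2 P := by
    have : MemLp (fun x : ℝ => (max 0 x) ^ 2) 2 (gaussianReal 0 s) := by
      rw [memLp_two_iff_integrable_sq (Measurable.aestronglyMeasurable (by fun_prop))]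
      refine Integrable.mono' (hid 4) (Measurable.aestronglyMeasurable (by fun_prop))
        (ae_of_all _ fun x => ?_)
      rw [Real.norm_of_nonneg (by positivity), ← pow_mul]
      rcases le_total 0 x with hx | hx
      · rw [max_eq_right hx]
      · rw [max_eq_left hx]; norm_num; positivity
    exact this.comp_measurePreserving hXp
  have hX1 : Integrable (fun f => max 0 (X f)) P := by
    have : Integrable (fun x : ℝ => max 0 x) (gaussianReal 0 s) := by
      have h1 := hid 1
      simp only [pow_one] at h1
      exact (integrable_const 0).sup h1
    exact hXp.integrable_comp_of_integrable this
  have key := aux_norm P V (by omega) (fun f => (max 0 (X f)) ^ 2) (fun f => sq_nonneg _) hY2 s hs0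
    (by rw [hmom 2, aux_two s hsne])
    (by simp only [← pow_mul]; rw [hmom 4, aux_four s hsne])
  -- inner integral
  have hinner : ∀ F : Fin V → Fin k × Fin k → ℝ,
      ∫ a, max 0 (∑ q, a q * max 0 (X (F q))) ∂(Measure.pi fun _ : Fin V => gaussianReal 0 va) =
        √va / √(2 * π) * √(∑ q, (max 0 (X (F q))) ^ 2) := by
    intro F
    have h1 := aux_map_sum va (fun q => max 0 (X (F q)))
    have h2 : ∫ a, max 0 (∑ q, a q * max 0 (X (F q)))
        ∂(Measure.pi fun _ : Fin V => gaussianReal 0 va) =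
        ∫ x, max 0 x ∂((Measure.pi fun _ : Fin V => gaussianReal 0 va).map
          (fun a => ∑ q, a q * max 0 (X (F q)))) := by
      rw [integral_map (Measurable.aemeasurable (by fun_prop))
        (Measurable.aestronglyMeasurable (by fun_prop))]
    rw [h2, h1, aux_one, NNReal.coe_mul,
      Real.coe_toNNReal _ (Finset.sum_nonneg fun q _ => sq_nonneg _), Real.sqrt_mul (by positivity)]
    ring
  have hint : Integrable (fun ω : (Fin V → Fin k × Fin k → ℝ) × (Fin V → ℝ) =>
      max 0 (∑ q, ω.2 q * max 0 (X (ω.1 q))))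
      ((Measure.pi fun _ : Fin V => P).prod (Measure.pi fun _ : Fin V => gaussianReal 0 va)) := by
    refine (integrable_const 0).sup (integrable_finsetSum _ fun q _ => ?_)
    have ha : Integrable (fun a : Fin V → ℝ => a q)
        (Measure.pi fun _ : Fin V => gaussianReal 0 va) :=
      (measurePreserving_eval (fun _ : Fin V => gaussianReal 0 va) q).integrable_comp_of_integrable
        ((memLp_id_gaussianReal (μ := 0) (v := va) 1).integrable (by simp))
    have hb : Integrable (fun F : Fin V → Fin k × Fin k → ℝ => max 0 (X (F q)))
        (Measure.pi fun _ : Fin V => P) :=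
      (measurePreserving_eval (fun _ : Fin V => P) q).integrable_comp_of_integrable hX1
    have := hb.mul_prod ha
    simpa only [mul_comm] using this
  rw [show (∫ ω : (Fin V → Fin k × Fin k → ℝ) × (Fin V → ℝ),
        max 0 (∑ q, ω.2 q * max 0 (∑ ij, ω.1 q ij * m ij))
        ∂((Measure.pi fun _ : Fin V => P).prod
          (Measure.pi fun _ : Fin V => gaussianReal 0 va))) = _ from
      (integral_prod _ hint).trans (integral_congr_ae (ae_of_all _ hinner))]
  rw [integral_const_mul]
  have hV' : (20 : ℝ) < V := by exact_mod_cast hV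
  have hfin : (V - 20) / √V * (√s / 2) ≤ √(V * s / 2) * (1 - 5 / (2 * V)) := by
    have e1 : √((V : ℝ) * s / 2) = √V * √s * √(1 / 2) := by
      rw [← Real.sqrt_mul (by positivity), ← Real.sqrt_mul (by positivity)]
      congr 1; ring
    have e2 : (1 : ℝ) / 2 ≤ √(1 / 2) := Real.le_sqrt_of_sq_le (by norm_num)
    have e3 : ((V : ℝ) - 20) / √V = √V * (1 - 20 / V) := by
      have : √(V : ℝ) ≠ 0 := by positivity
      have h := Real.mul_self_sqrt (by positivity : (0 : ℝ) ≤ V)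
      field_simp
      rw [Real.sq_sqrt (by positivity)]
      ring
    rw [e1, e3]
    have e4 : (1 : ℝ) - 20 / V ≤ 1 - 5 / (2 * V) := by
      have : (5 : ℝ) / (2 * V) ≤ 20 / V := by
        rw [div_le_div_iff₀ (by positivity) (by positivity)]; linarith
      linarith
    have e5 : (0 : ℝ) ≤ 1 - 20 / V := by
      rw [sub_nonneg, div_le_one (by positivity)]; exact hV'.le
    calc √V * (1 - 20 / V) * (√s / 2) = √V * √s * ((1 / 2) * (1 - 20 / V)) := by ring
      _ ≤ √V * √s * (√(1 / 2) * (1 - 5 / (2 * V))) := by gcongr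
      _ = _ := by ring
  have hconst : √((h' * w' : ℕ) / (16 * π)) * (τ ^ 2 / (h * w : ℕ)) * √M
      = √va / √(2 * π) * (√s / 2) := by
    have hhw : (0 : ℝ) < (h * w : ℕ) := by exact_mod_cast Nat.mul_pos hh hw
    rw [hsr, hvar, Real.sqrt_mul (sq_nonneg τ) M, Real.sqrt_sq hτ.le, mul_div_assoc,
      Real.sqrt_mul (sq_nonneg (τ / ((h * w : ℕ) : ℝ))), Real.sqrt_sq (by positivity)]
    have e : √(((h' * w' : ℕ) : ℝ) / (16 * π)) = √(((h' * w' : ℕ) : ℝ) / 2) / √(2 * π) / 2 := by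
      rw [← Real.sqrt_div (by positivity)]
      rw [show ((h' * w' : ℕ) : ℝ) / (16 * π) = (((h' * w' : ℕ) : ℝ) / 2 / (2 * π)) / 2 ^ 2 by
        field_simp; norm_num]
      rw [Real.sqrt_div (by positivity), Real.sqrt_sq (by norm_num)]
    rw [e]
    ring
  calc ((V : ℝ) - 20) / √V * √((h' * w' : ℕ) / (16 * π)) * (τ ^ 2 / (h * w : ℕ)) * √M
      = ((V : ℝ) - 20) / √V * (√((h' * w' : ℕ) / (16 * π)) * (τ ^ 2 / (h * w : ℕ)) * √M) := by ring
    _ = √va / √(2 * π) * ((V - 20) / √V * (√s / 2)) := by rw [hconst]; ring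
    _ ≤ _ := by
        refine mul_le_mul_of_nonneg_left (hfin.trans key) (by positivity)
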